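/- Let n be an even positive integer and k a positive integer. Let G̃ be the unweighted graph on vertex set {0,…,n−1} × {1,…,k} consisting, for each u, of a complete bipartite graph between all pairs of vertices (u,i) and (v,j) with v = u ± 1 (mod n). Let G be G̃ together with one additional edge e of weight 1 from (0,1) to (n/2,1). Let x be the vector with x(u,i) = min(u, n−u). Then x^T L_{G̃} x = n·k² and x^T L_G x = n·k² + (n/2)². Consequently, G̃ is not a σ-spectral approximation of G for any σ < 1 + n/(4k²). -/

import Mathlib

/-- The Laplacian quadratic form of a weighted graph given by a symmetric
weight function indexed by an arbitrary finite vertex type.  The double sum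
counts every unordered edge twice, whence the factor `1/2`. -/
noncomputable def lapQ {V : Type*} [Fintype V] (w : V → V → ℝ) (x : V → ℝ) : ℝ :=
  (1 / 2) * ∑ u, ∑ v, w u v * (x u - x v) ^ 2

theorem step_sq (n : ℕ) (hne : Even n) (u v : ℕ) (hu : u < n) (h : (u + 1) % n = v) :
    (min (u : ℝ) ((n : ℝ) - u) - min (v : ℝ) ((n : ℝ) - v)) ^ 2 = 1 := by
  obtain ⟨m, rfl⟩ := hne
  rcases Nat.lt_or_ge (u + 1) (m + m) with h1 | h1
  · rw [Nat.mod_eq_of_lt h1] at h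
    subst h
    rcases Nat.lt_or_ge u m with h2 | h2
    · have h3 : (u : ℝ) + 1 ≤ m := by exact_mod_cast h2
      rw [min_eq_left (by push_cast; linarith), min_eq_left (by push_cast; linarith)]
      push_cast; ring
    · have h3 : (m : ℝ) ≤ u := by exact_mod_cast h2
      rw [min_eq_right (by push_cast; linarith), min_eq_right (by push_cast; linarith)]
      push_cast; ring
  · have h4 : u + 1 = m + m := by omega
    rw [h4, Nat.mod_self] at h
    subst h
    have h5 : (u : ℝ) + 1 = m + m := by exact_mod_cast h4
    have h6 : (1 : ℝ) ≤ m := by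
      have : 1 ≤ m := by omega
      exact_mod_cast this
    rw [min_eq_right (by push_cast; linarith), min_eq_left (by push_cast; linarith)]
    push_cast
    rw [← h5]; ring

theorem half_sum (n k : ℕ) (hn : 0 < n) (hne : Even n) (x : Fin n × Fin k → ℝ)
    (hx : ∀ a, x a = min ((a.1 : ℕ) : ℝ) ((n : ℝ) - ((a.1 : ℕ) : ℝ))) :
    ∑ a : Fin n × Fin k, ∑ b : Fin n × Fin k,
      (if ((a.1 : ℕ) + 1) % n = (b.1 : ℕ) then (1 : ℝ) else 0) * (x a - x b) ^ 2
      = (n : ℝ) * (k : ℝ) ^ 2 := by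
  have key : ∀ a : Fin n × Fin k, ∑ b : Fin n × Fin k,
      (if ((a.1 : ℕ) + 1) % n = (b.1 : ℕ) then (1 : ℝ) else 0) * (x a - x b) ^ 2 = k := by
    intro a
    have h1 : ∀ b : Fin n × Fin k,
        (if ((a.1 : ℕ) + 1) % n = (b.1 : ℕ) then (1 : ℝ) else 0) * (x a - x b) ^ 2 =
        if (⟨((a.1 : ℕ) + 1) % n, Nat.mod_lt _ hn⟩ : Fin n) = b.1 then (1 : ℝ) else 0 := by
      intro b
      by_cases h : ((a.1 : ℕ) + 1) % n = (b.1 : ℕ)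
      · rw [if_pos h, if_pos (Fin.ext h), hx a, hx b, step_sq n hne _ _ a.1.2 h, one_mul]
      · rw [if_neg h, if_neg (fun h' => h (congrArg Fin.val h')), zero_mul]
    rw [Finset.sum_congr rfl (fun b _ => h1 b), Fintype.sum_prod_type_right]
    simp
  rw [Finset.sum_congr rfl (fun a _ => key a)]
  simp
  ring

/--
**cut sparsifiers vs. spectral sparsifiers.**
Let `n` be even and positive, `k ≥ 1`.  `G̃` (weight function `wt`) consists of
`n` complete bipartite graphs between consecutive columns
`{u} × {1..k}` and `{u+1 mod n} × {1..k}` of the vertex set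
`{0..n−1} × {1..k}` (the two indicator terms add up, so that graph summation is
respected when `n = 2`).  `G` (weight function `w`) is `G̃` plus one extra edge
`e` of weight `1` from `(0,1)` to `(n/2,1)`.  For the vector
`x(u,i) = min(u, n−u)` one has `xᵀL_{G̃}x = nk²` and
`xᵀL_Gx = nk² + (n/2)²`; consequently `G̃` is not a `σ`-spectral approximation
of `G` for any `σ < 1 + n/(4k²)`.
-/
theorem stmt13 (n k : ℕ) (hn : 0 < n) (hne : Even n) (hk : 0 < k)
    (wt w : Fin n × Fin k → Fin n × Fin k → ℝ)
    (hwt : ∀ a b, wt a b =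
      (if ((a.1 : ℕ) + 1) % n = (b.1 : ℕ) then (1 : ℝ) else 0) +
        (if ((b.1 : ℕ) + 1) % n = (a.1 : ℕ) then (1 : ℝ) else 0))
    (hw : ∀ a b, w a b = wt a b +
      (if (a = (⟨0, hn⟩, ⟨0, hk⟩) ∧
             b = (⟨n / 2, Nat.div_lt_self hn one_lt_two⟩, ⟨0, hk⟩)) ∨
          (b = (⟨0, hn⟩, ⟨0, hk⟩) ∧
             a = (⟨n / 2, Nat.div_lt_self hn one_lt_two⟩, ⟨0, hk⟩))
        then (1 : ℝ) else 0))
    (x : Fin n × Fin k → ℝ)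
    (hx : ∀ a, x a = min ((a.1 : ℕ) : ℝ) ((n : ℝ) - ((a.1 : ℕ) : ℝ))) :
    lapQ wt x = (n : ℝ) * (k : ℝ) ^ 2 ∧
    lapQ w x = (n : ℝ) * (k : ℝ) ^ 2 + ((n : ℝ) / 2) ^ 2 ∧
    ∀ σ : ℝ, σ < 1 + (n : ℝ) / (4 * (k : ℝ) ^ 2) →
      ¬ (∀ y : Fin n × Fin k → ℝ,
          (1 / σ) * lapQ wt y ≤ lapQ w y ∧ lapQ w y ≤ σ * lapQ wt y) := by
  have e1 : lapQ wt x = (n : ℝ) * (k : ℝ) ^ 2 := by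
    have h := half_sum n k hn hne x hx
    have h' := h
    rw [Finset.sum_comm] at h'
    unfold lapQ
    have : ∑ a, ∑ b, wt a b * (x a - x b) ^ 2 =
        (n : ℝ) * (k : ℝ) ^ 2 + (n : ℝ) * (k : ℝ) ^ 2 := by
      nth_rewrite 1 [← h]
      rw [← h', ← Finset.sum_add_distrib]
      refine Finset.sum_congr rfl fun a _ => ?_
      rw [← Finset.sum_add_distrib]
      refine Finset.sum_congr rfl fun b _ => ?_
      rw [hwt]; ring
    rw [this]; ring
  have e2 : lapQ w x = (n : ℝ) * (k : ℝ) ^ 2 + ((n : ℝ) / 2) ^ 2 := by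
    rw [← e1]
    unfold lapQ
    set p : Fin n × Fin k := (⟨0, hn⟩, ⟨0, hk⟩) with hp
    set q : Fin n × Fin k := (⟨n / 2, Nat.div_lt_self hn one_lt_two⟩, ⟨0, hk⟩) with hq
    have hn2 : ((n / 2 : ℕ) : ℝ) = (n : ℝ) / 2 := by
      obtain ⟨m, rfl⟩ := hne
      have : (m + m) / 2 = m := by omega
      rw [this]; push_cast; ring
    have hnp : (0 : ℝ) < n := by exact_mod_cast hn
    have hxp : x p = 0 := by rw [hx]; simp [hp]
    have hxq : x q = (n : ℝ) / 2 := by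
      rw [hx]; simp only [hq, hn2]
      rw [min_eq_left (by linarith)]
    have hpq : p ≠ q := by
      intro h
      rw [h, hxq] at hxp
      linarith
    have h1 : ∀ a b, w a b * (x a - x b) ^ 2 = wt a b * (x a - x b) ^ 2 +
        ((if a = p then (if b = q then ((n : ℝ) / 2) ^ 2 else 0) else 0) +
         (if a = q then (if b = p then ((n : ℝ) / 2) ^ 2 else 0) else 0)) := by
      intro a b
      rw [hw, add_mul]
      congr 1
      by_cases ha : a = p
      · subst ha
        by_cases hb : b = q
        · subst hb; simp [hxp, hxq, hpq]
        · simp [hb, hpq]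
      · by_cases ha' : a = q
        · subst ha'
          by_cases hb : b = p
          · subst hb; simp [hxp, hxq, hpq.symm]
          · simp [hb, hpq.symm]
        · simp [ha, ha']
    simp only [h1, Finset.sum_add_distrib]
    simp
    ring
  refine ⟨e1, e2, ?_⟩
  intro σ hσ H
  have h := (H x).2
  rw [e1, e2] at h
  have hnp : (0 : ℝ) < n := by exact_mod_cast hn
  have hkp : (0 : ℝ) < k := by exact_mod_cast hk
  have h2 := mul_lt_mul_of_pos_right hσ (show (0 : ℝ) < (n : ℝ) * (k : ℝ) ^ 2 by positivity)
  have h3 : (1 + (n : ℝ) / (4 * (k : ℝ) ^ 2)) * ((n : ℝ) * (k : ℝ) ^ 2) =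
      (n : ℝ) * (k : ℝ) ^ 2 + ((n : ℝ) / 2) ^ 2 := by
    field_simp
    ring
  linarith
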